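/- Asymptotic equivalence of the univariate PN scheme with the linear scheme (first assertion of Theorem 1): let a : ℤ → ℝ be a mask supported in {−B,…,B} with Σ_j a_{2j} = Σ_j a_{2j+1} = 1, and let n^k : ℤ → ℝ^d (k ∈ ℕ) be sequences of unit vectors such that (i) ‖n_j^k − n_l^k‖ ≤ c₁ γ^k whenever |j − l| ≤ 2B, where c₁ > 0 and 0 < γ < 1 are constants, and (ii) ⟨n_i^{k+1}, n_j^k⟩ ≥ 0 whenever a_{i−2j} ≠ 0. Define A_{ij}^k = A(n_i^{k+1}, n_j^k) and M_{ij}^k = I + Σ_{l∈ℤ} a_{i−2l}(A_{ij}^k − A_{il}^k). Then there exists a constant c_M > 0 such that sup_{i∈ℤ} Σ_{j∈ℤ} |a_{i−2j}| · ‖M_{ij}^k − I‖ ≤ c_M γ^k for all k ∈ ℕ; in particular Σ_{k∈ℕ} sup_{i∈ℤ} Σ_{j∈ℤ} |a_{i−2j}| ‖M_{ij}^k − I‖ < +∞, i.e. the nonstationary PN scheme {S_a ∘ M^k} is asymptotically equivalent to the stationary linear scheme S_a. -/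

import Mathlib

open scoped RealInnerProductSpace BigOperators

noncomputable section

variable {d : ℕ}

/-- The projection map `A(X₁, X₂) : v ↦ (⟨X₁ + X₂, v⟩ / ⟨X₁ + X₂, X₁⟩) · X₁`. -/
def Amap (X₁ X₂ : EuclideanSpace ℝ (Fin d)) :
    EuclideanSpace ℝ (Fin d) →L[ℝ] EuclideanSpace ℝ (Fin d) :=
  (⟪X₁ + X₂, X₁⟫)⁻¹ • (innerSL ℝ (X₁ + X₂)).smulRight X₁

/-- `A_{ij}^k = A(n_i^{k+1}, n_j^k)` for the subdivided normals `n^k`. -/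
def pnA (n : ℕ → ℤ → EuclideanSpace ℝ (Fin d)) (k : ℕ) (i j : ℤ) :
    EuclideanSpace ℝ (Fin d) →L[ℝ] EuclideanSpace ℝ (Fin d) :=
  Amap (n (k + 1) i) (n k j)

/-- The PN perturbation matrices `M_{ij}^k = I + Σ_l a_{i-2l}(A_{ij}^k − A_{il}^k)`. -/
def pnM (a : ℤ → ℝ) (n : ℕ → ℤ → EuclideanSpace ℝ (Fin d)) (k : ℕ) (i j : ℤ) :
    EuclideanSpace ℝ (Fin d) →L[ℝ] EuclideanSpace ℝ (Fin d) :=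
  1 + ∑ᶠ l : ℤ, a (i - 2 * l) • (pnA n k i j - pnA n k i l)

/-- On unit vectors `Y`, `Z` in the closed half-space of `X`, the projection map `Amap X` is
Lipschitz with constant `3`. -/
theorem norm_Amap_sub_Amap_le {X Y Z : EuclideanSpace ℝ (Fin d)} (hX : ‖X‖ = 1) (hZ : ‖Z‖ = 1)
    (hXY : 0 ≤ ⟪X, Y⟫) (hXZ : 0 ≤ ⟪X, Z⟫) :
    ‖Amap X Y - Amap X Z‖ ≤ 3 * ‖Y - Z‖ := by
  have hXX : ⟪X, X⟫ = 1 := by rw [real_inner_self_eq_norm_sq, hX, one_pow]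
  have hs : ⟪X + Y, X⟫ = 1 + ⟪X, Y⟫ := by rw [inner_add_left, hXX, real_inner_comm]
  have ht : ⟪X + Z, X⟫ = 1 + ⟪X, Z⟫ := by rw [inner_add_left, hXX, real_inner_comm]
  have hs_inv : |(1 + ⟪X, Y⟫)⁻¹| ≤ 1 := by
    rw [abs_of_nonneg (by positivity)]
    exact inv_le_one_of_one_le₀ (by linarith)
  have ht_inv : |(1 + ⟪X, Z⟫)⁻¹| ≤ 1 := by
    rw [abs_of_nonneg (by positivity)]
    exact inv_le_one_of_one_le₀ (by linarith)
  have hdiff : |(1 + ⟪X, Y⟫)⁻¹ - (1 + ⟪X, Z⟫)⁻¹| ≤ ‖Y - Z‖ := by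
    have hinner : |⟪X, Z - Y⟫| ≤ ‖Y - Z‖ := by
      have h := abs_real_inner_le_norm X (Z - Y)
      rwa [hX, one_mul, norm_sub_rev] at h
    have hfactor : (1 + ⟪X, Y⟫)⁻¹ - (1 + ⟪X, Z⟫)⁻¹ =
        (1 + ⟪X, Y⟫)⁻¹ * (1 + ⟪X, Z⟫)⁻¹ * ⟪X, Z - Y⟫ := by
      have h₁ : 1 + ⟪X, Y⟫ ≠ 0 := by positivity
      have h₂ : 1 + ⟪X, Z⟫ ≠ 0 := by positivity
      rw [inner_sub_right]
      field_simp
      ring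
    rw [hfactor, abs_mul, abs_mul]
    exact (mul_le_of_le_one_left (abs_nonneg _)
      (mul_le_one₀ hs_inv (abs_nonneg _) ht_inv)).trans hinner
  have hXZ_norm : ‖X + Z‖ ≤ 2 := (norm_add_le X Z).trans (by rw [hX, hZ]; norm_num)
  refine ContinuousLinearMap.opNorm_le_bound _ (by positivity) fun v => ?_
  have hv : (Amap X Y - Amap X Z) v =
      ((1 + ⟪X, Y⟫)⁻¹ * ⟪Y - Z, v⟫ +
        ((1 + ⟪X, Y⟫)⁻¹ - (1 + ⟪X, Z⟫)⁻¹) * ⟪X + Z, v⟫) • X := by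
    simp only [Amap, hs, ht, sub_apply, smul_apply,
      ContinuousLinearMap.smulRight_apply, innerSL_apply_apply, smul_smul, ← sub_smul,
      inner_add_left, inner_sub_left]
    congr 1
    ring
  rw [hv, norm_smul, hX, mul_one, Real.norm_eq_abs]
  calc _ ≤ |(1 + ⟪X, Y⟫)⁻¹| * |⟪Y - Z, v⟫| +
        |(1 + ⟪X, Y⟫)⁻¹ - (1 + ⟪X, Z⟫)⁻¹| * |⟪X + Z, v⟫| := by
        rw [← abs_mul, ← abs_mul]
        exact abs_add_le _ _
    _ ≤ 1 * (‖Y - Z‖ * ‖v‖) + ‖Y - Z‖ * (2 * ‖v‖) := by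
        gcongr
        · exact abs_real_inner_le_norm _ _
        · exact (abs_real_inner_le_norm _ _).trans (by gcongr)
    _ = 3 * ‖Y - Z‖ * ‖v‖ := by ring

/-- A weighted sum of bounded vectors, with weights a coset of a finitely supported mask. -/
theorem norm_finsum_mask_smul_le {E : Type*} [NormedAddCommGroup E] [NormedSpace ℝ E]
    {B : ℕ} {a : ℤ → ℝ} (hsupp : ∀ i : ℤ, a i ≠ 0 → |i| ≤ (B : ℤ)) (i : ℤ) {f : ℤ → E} {C : ℝ}
    (hC : 0 ≤ C) (hf : ∀ j, a (i - 2 * j) ≠ 0 → ‖f j‖ ≤ C) :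
    ‖∑ᶠ j : ℤ, a (i - 2 * j) • f j‖ ≤ (∑ m ∈ Finset.Icc (-(B : ℤ)) B, |a m|) * C := by
  have hmem : ∀ m, a m ≠ 0 → m ∈ Finset.Icc (-(B : ℤ)) B := fun m hm =>
    Finset.mem_Icc.2 (abs_le.1 (hsupp m hm))
  have hsub : (Function.support fun j : ℤ => a (i - 2 * j) • f j) ⊆
      (Finset.Icc (-(|i| + B)) (|i| + B) : Finset ℤ) := by
    intro j hj
    have ha := Finset.mem_Icc.1 (hmem _ (left_ne_zero_of_smul hj))
    have h₁ := le_abs_self i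
    have h₂ := neg_abs_le i
    simp only [Finset.coe_Icc, Set.mem_Icc]
    constructor <;> omega
  have hinj : Function.Injective fun j : ℤ => i - 2 * j := fun x y h => by
    simp only at h
    omega
  rw [finsum_eq_sum_of_support_subset _ hsub]
  calc _ ≤ ∑ j ∈ Finset.Icc (-(|i| + B)) (|i| + B), |a (i - 2 * j)| * C := by
        refine norm_sum_le_of_le _ fun j _ => ?_
        rw [norm_smul, Real.norm_eq_abs]
        by_cases hj : a (i - 2 * j) = 0
        · simp [hj]
        · gcongr
          exact hf j hj
    _ = (∑ m ∈ (Finset.Icc (-(|i| + B)) (|i| + B)).image fun j => i - 2 * j, |a m|) * C := by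
        rw [Finset.sum_image hinj.injOn, Finset.sum_mul]
    _ ≤ _ := by
        gcongr ?_ * C
        rw [← Finset.sum_filter_ne_zero]
        refine Finset.sum_le_sum_of_subset_of_nonneg (fun m hm => hmem m ?_)
          fun _ _ _ => abs_nonneg _
        simpa using (Finset.mem_filter.1 hm).2

/-- Asymptotic equivalence of the univariate PN scheme with the linear
scheme (first assertion of Theorem 1).  With a mask supported in `{−B,…,B}` whose even
and odd entries each sum to `1`, and subdivided unit normals `n^k` that are locally
contracting (`‖n_j^k − n_l^k‖ ≤ c₁ γ^k` for `|j−l| ≤ 2B`) with nonnegative inner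
products on the support of the mask, the matrices `M_{ij}^k` satisfy
`sup_i Σ_j |a_{i−2j}| ‖M_{ij}^k − I‖ ≤ c_M γ^k`; in particular the sum over `k` of
these quantities is finite, i.e. `{S_a ∘ M^k}` is asymptotically equivalent to `S_a`. -/
theorem pn_asymptotically_equivalent
    (B : ℕ) (a : ℤ → ℝ) (hsupp : ∀ i : ℤ, a i ≠ 0 → |i| ≤ (B : ℤ))
    (heven : ∑ᶠ j : ℤ, a (2 * j) = 1) (hodd : ∑ᶠ j : ℤ, a (2 * j + 1) = 1)
    (n : ℕ → ℤ → EuclideanSpace ℝ (Fin d))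
    (hunit : ∀ (k : ℕ) (j : ℤ), ‖n k j‖ = 1)
    (c₁ γ : ℝ) (hc₁ : 0 < c₁) (hγ₀ : 0 < γ) (hγ₁ : γ < 1)
    (hclose : ∀ (k : ℕ) (j l : ℤ), |j - l| ≤ 2 * (B : ℤ) → ‖n k j - n k l‖ ≤ c₁ * γ ^ k)
    (hinner : ∀ (k : ℕ) (i j : ℤ), a (i - 2 * j) ≠ 0 → 0 ≤ ⟪n (k + 1) i, n k j⟫) :
    ∃ c_M > (0 : ℝ),
      (∀ (k : ℕ) (i : ℤ),
        ∑ᶠ j : ℤ, |a (i - 2 * j)| * ‖pnM a n k i j - 1‖ ≤ c_M * γ ^ k) ∧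
      Summable (fun k : ℕ =>
        ⨆ i : ℤ, ∑ᶠ j : ℤ, |a (i - 2 * j)| * ‖pnM a n k i j - 1‖) := by
  set S := ∑ m ∈ Finset.Icc (-(B : ℤ)) B, |a m| with hS
  have hS₀ : 0 ≤ S := Finset.sum_nonneg fun _ _ => abs_nonneg _
  have hM : ∀ (k : ℕ) (i j : ℤ), a (i - 2 * j) ≠ 0 →
      ‖pnM a n k i j - 1‖ ≤ S * (3 * (c₁ * γ ^ k)) := by
    intro k i j hj
    rw [pnM, add_sub_cancel_left]
    have hC : 0 ≤ 3 * (c₁ * γ ^ k) := by positivity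
    refine norm_finsum_mask_smul_le (f := fun l => pnA n k i j - pnA n k i l) hsupp i hC
      fun l hl => ?_
    refine (norm_Amap_sub_Amap_le (hunit _ _) (hunit _ _) (hinner k i j hj)
      (hinner k i l hl)).trans ?_
    gcongr
    have h₁ := abs_le.1 (hsupp _ hj)
    have h₂ := abs_le.1 (hsupp _ hl)
    exact hclose k j l (abs_le.2 (by constructor <;> omega))
  have hrow : ∀ (k : ℕ) (i : ℤ),
      ∑ᶠ j : ℤ, |a (i - 2 * j)| * ‖pnM a n k i j - 1‖ ≤ (S * S * 3 * c₁ + 1) * γ ^ k := by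
    intro k i
    have h := norm_finsum_mask_smul_le (a := fun m => |a m|) (B := B)
      (fun m hm => hsupp m (by simpa using hm)) i
      (f := fun j => ‖pnM a n k i j - 1‖) (C := S * (3 * (c₁ * γ ^ k))) (by positivity)
      (fun j hj => by simpa using hM k i j (by simpa using hj))
    simp only [smul_eq_mul, abs_abs, ← hS] at h
    have hγk : 0 ≤ γ ^ k := by positivity
    linarith [le_of_abs_le h]
  refine ⟨S * S * 3 * c₁ + 1, by positivity, hrow, ?_⟩
  refine Summable.of_nonneg_of_le (fun k => ?_) (fun k => ?_)
    ((summable_geometric_of_lt_one hγ₀.le hγ₁).mul_left (S * S * 3 * c₁ + 1))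
  · exact Real.iSup_nonneg fun i => finsum_nonneg fun j => by positivity
  · exact Real.iSup_le (hrow k) (by positivity)
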